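/- Let p < q be coprime positive integers. If A is a family of subsets of {1,...,n} such that p|A \ B| ≠ q|B \ A| for all distinct A, B in A, then |A| ≤ (q − p + o(1)) · C(n, ⌊n/2⌋) as n → ∞. -/

import Mathlib

/-- Every set of size `#C` is the image of `C` under equally many permutations. -/
theorem card_filter_map_mem_mul_choose {α : Type*} [Fintype α] [DecidableEq α]
    (𝒜 : Finset (Finset α)) (C : Finset α) :
    (Finset.univ.filter fun σ : Equiv.Perm α => C.map σ.toEmbedding ∈ 𝒜).card
        * (Fintype.card α).choose C.card
      = (𝒜.filter fun A => A.card = C.card).card * (Fintype.card α).factorial := by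
  classical
  let N : Finset α → ℕ := fun D =>
    (Finset.univ.filter fun σ : Equiv.Perm α => C.map σ.toEmbedding = D).card
  have hN : ∀ D : Finset α, D.card = C.card → N D = N C := by
    intro D hD
    let e : {x // x ∈ C} ≃ {x // x ∈ D} := Finset.equivOfCardEq hD.symm
    let τ : Equiv.Perm α := e.extendSubtype
    have hτ : C.map τ.toEmbedding = D := by
      apply Finset.eq_of_subset_of_card_le
      · intro x hx
        obtain ⟨y, hy, rfl⟩ := Finset.mem_map.1 hx
        exact e.extendSubtype_mem y hy
      · simp [hD]
    symm
    refine Finset.card_bij (fun σ _ => τ * σ) ?_ ?_ ?_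
    · intro σ hσ
      simp only [Finset.mem_filter, Finset.mem_univ, true_and] at hσ ⊢
      rw [← hτ]
      conv_rhs => rw [← hσ]
      rw [Finset.map_map]
      rfl
    · intro σ _ σ' _ h
      exact mul_left_cancel h
    · intro σ hσ
      refine ⟨τ⁻¹ * σ, ?_, by simp⟩
      simp only [Finset.mem_filter, Finset.mem_univ, true_and] at hσ ⊢
      apply Finset.map_injective τ.toEmbedding
      rw [hτ, Finset.map_map, ← hσ]
      congr 1
      ext x
      simp
  have hcount : ∀ ℬ : Finset (Finset α),
      (Finset.univ.filter fun σ : Equiv.Perm α => C.map σ.toEmbedding ∈ ℬ).card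
        = (ℬ.filter fun A => A.card = C.card).card * N C := by
    intro ℬ
    rw [Finset.card_eq_sum_card_fiberwise (f := fun σ : Equiv.Perm α => C.map σ.toEmbedding)
      (t := ℬ.filter fun A => A.card = C.card)]
    · rw [← smul_eq_mul, ← Finset.sum_const]
      refine Finset.sum_congr rfl fun D hD => ?_
      rw [Finset.mem_filter] at hD
      rw [← hN D hD.2, Finset.filter_filter]
      congr 1
      ext σ
      simp only [Finset.mem_filter, Finset.mem_univ, true_and]
      exact ⟨fun h => h.2, fun h => ⟨h ▸ hD.1, h⟩⟩
    · intro σ hσ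
      simpa using hσ
  have hall := hcount Finset.univ
  have hlevel : (Finset.univ.filter fun A : Finset α => A.card = C.card).card
      = (Fintype.card α).choose C.card := by
    rw [← Finset.card_univ, ← Finset.card_powersetCard]
    congr 1
    ext A
    simp [Finset.mem_powersetCard]
  rw [hlevel] at hall
  simp only [Finset.mem_univ, Finset.filter_true, Finset.card_univ, Fintype.card_perm] at hall
  rw [hcount, hall]
  ring

/-- A chain argument in the style of Lubell: if every image of the sequence `C` under a
permutation meets `𝒜` at most once, then the part of `𝒜` on the levels of `C` has at most the
size of the middle layer. -/
theorem card_filter_le_choose_middle {α ι : Type*} [Fintype α] [DecidableEq α]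
    (𝒜 : Finset (Finset α)) (I : Finset ι) (C : ι → Finset α)
    (h : ∀ σ : Equiv.Perm α, ∀ i ∈ I, ∀ j ∈ I,
      (C i).map σ.toEmbedding ∈ 𝒜 → (C j).map σ.toEmbedding ∈ 𝒜 → i = j) :
    (𝒜.filter fun A => A.card ∈ I.image fun i => (C i).card).card
      ≤ (Fintype.card α).choose (Fintype.card α / 2) := by
  classical
  refine Nat.le_of_mul_le_mul_right ?_ (Nat.factorial_pos (Fintype.card α))
  have hone : ∑ i ∈ I, (Finset.univ.filter fun σ : Equiv.Perm α =>
      (C i).map σ.toEmbedding ∈ 𝒜).card ≤ (Fintype.card α).factorial := by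
    rw [← Fintype.card_perm, ← Finset.card_univ, ← Finset.card_biUnion]
    · exact Finset.card_le_card (Finset.subset_univ _)
    · intro i hi j hj hij
      refine Finset.disjoint_left.2 fun σ hσi hσj => hij ?_
      simp only [Finset.mem_filter, Finset.mem_univ, true_and] at hσi hσj
      exact h σ i hi j hj hσi hσj
  calc (𝒜.filter fun A => A.card ∈ I.image fun i => (C i).card).card * (Fintype.card α).factorial
      ≤ (∑ i ∈ I, (𝒜.filter fun A => A.card = (C i).card).card)
          * (Fintype.card α).factorial := by
        refine Nat.mul_le_mul_right _ (le_trans (Finset.card_le_card ?_) Finset.card_biUnion_le)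
        intro A hA
        obtain ⟨hA, h⟩ := Finset.mem_filter.1 hA
        obtain ⟨i, hi, h⟩ := Finset.mem_image.1 h
        exact Finset.mem_biUnion.2 ⟨i, hi, Finset.mem_filter.2 ⟨hA, h.symm⟩⟩
    _ = ∑ i ∈ I, (Finset.univ.filter fun σ : Equiv.Perm α =>
          (C i).map σ.toEmbedding ∈ 𝒜).card * (Fintype.card α).choose (C i).card := by
        rw [Finset.sum_mul]
        exact Finset.sum_congr rfl fun i _ => (card_filter_map_mem_mul_choose 𝒜 (C i)).symm
    _ ≤ ∑ i ∈ I, (Finset.univ.filter fun σ : Equiv.Perm α =>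
          (C i).map σ.toEmbedding ∈ 𝒜).card
            * (Fintype.card α).choose (Fintype.card α / 2) :=
        Finset.sum_le_sum fun i _ => Nat.mul_le_mul_left _ (Nat.choose_le_middle _ _)
    _ ≤ (Fintype.card α).choose (Fintype.card α / 2) * (Fintype.card α).factorial := by
        rw [← Finset.sum_mul, mul_comm]
        exact Nat.mul_le_mul_left _ hone

theorem card_filter_fin_Ico {n a b : ℕ} (hb : b ≤ n) :
    (Finset.univ.filter fun x : Fin n => a ≤ (x : ℕ) ∧ (x : ℕ) < b).card = b - a := by
  rw [← Nat.card_Ico, ← Finset.card_map Fin.valEmbedding]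
  congr 1
  ext x
  simp only [Finset.mem_map, Finset.mem_filter, Finset.mem_univ, true_and,
    Fin.valEmbedding_apply, Finset.mem_Ico]
  exact ⟨by rintro ⟨y, hy, rfl⟩; exact hy, fun hx => ⟨⟨x, by omega⟩, hx, rfl⟩⟩

/-- The `i`-th set of a sequence in which each step gains `q` elements and loses `p`. -/
def tiltedChain (n p q m r i : ℕ) : Finset (Fin n) :=
  Finset.univ.filter fun x =>
    (0 ≤ (x : ℕ) ∧ (x : ℕ) < q * i) ∨
      (q * m + p * i ≤ (x : ℕ) ∧ (x : ℕ) < q * m + p * m + r)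

theorem card_tiltedChain {n p q m r i : ℕ} (hn : q * m + p * m + r ≤ n) (hi : i ≤ m) :
    (tiltedChain n p q m r i).card + p * i = p * m + r + q * i := by
  have hq : q * i ≤ q * m := Nat.mul_le_mul_left _ hi
  have hp : p * i ≤ p * m := Nat.mul_le_mul_left _ hi
  rw [tiltedChain, Finset.filter_or, Finset.card_union_of_disjoint, card_filter_fin_Ico (by omega),
    card_filter_fin_Ico hn]
  · omega
  · refine Finset.disjoint_filter.2 fun x _ h1 h2 => ?_
    omega

theorem tiltedChain_sdiff {n p q m r i j : ℕ} (hn : q * m + p * m + r ≤ n) (hij : i ≤ j)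
    (hj : j ≤ m) :
    (tiltedChain n p q m r j \ tiltedChain n p q m r i).card = q * j - q * i ∧
      (tiltedChain n p q m r i \ tiltedChain n p q m r j).card = p * j - p * i := by
  have hq : q * j ≤ q * m := Nat.mul_le_mul_left _ hj
  have hp : p * j ≤ p * m := Nat.mul_le_mul_left _ hj
  have hq' : q * i ≤ q * j := Nat.mul_le_mul_left _ hij
  have hp' : p * i ≤ p * j := Nat.mul_le_mul_left _ hij
  constructor
  · rw [← card_filter_fin_Ico (n := n) (a := q * i) (b := q * j) (by omega)]
    congr 1
    ext x
    simp only [tiltedChain, Finset.mem_sdiff, Finset.mem_filter, Finset.mem_univ, true_and]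
    omega
  · rw [show p * j - p * i = (q * m + p * j) - (q * m + p * i) by omega,
      ← card_filter_fin_Ico (n := n) (a := q * m + p * i) (b := q * m + p * j) (by omega)]
    congr 1
    ext x
    simp only [tiltedChain, Finset.mem_sdiff, Finset.mem_filter, Finset.mem_univ, true_and]
    omega

theorem card_filter_tiltedChain_le {n p q m r : ℕ} (hq : 0 < q) (hn : q * m + p * m + r ≤ n)
    (𝒜 : Finset (Finset (Fin n)))
    (h𝒜 : ∀ A ∈ 𝒜, ∀ B ∈ 𝒜, A ≠ B → p * (A \ B).card ≠ q * (B \ A).card) :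
    (𝒜.filter fun A : Finset (Fin n) =>
      A.card ∈ (Finset.range (m + 1)).image fun i => (tiltedChain n p q m r i).card).card ≤ n.choose (n / 2) := by
  have key : ∀ σ : Equiv.Perm (Fin n), ∀ i j, i < j → j ≤ m →
      (tiltedChain n p q m r i).map σ.toEmbedding ∈ 𝒜 →
      (tiltedChain n p q m r j).map σ.toEmbedding ∈ 𝒜 → False := by
    intro σ i j hij hj hi' hj'
    obtain ⟨h1, h2⟩ := tiltedChain_sdiff hn hij.le hj
    have hlt : q * i < q * j := Nat.mul_lt_mul_of_pos_left hij hq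
    refine h𝒜 _ hj' _ hi' ?_ ?_
    · intro h
      rw [Finset.map_injective _ h] at h1
      simp at h1
      omega
    · rw [← Finset.map_sdiff, ← Finset.map_sdiff, Finset.card_map, Finset.card_map, h1, h2,
        ← Nat.mul_sub, ← Nat.mul_sub, Nat.mul_left_comm]
  have := card_filter_le_choose_middle 𝒜 (Finset.range (m + 1)) (tiltedChain n p q m r) (by
    intro σ i hi j hj hi' hj'
    rw [Finset.mem_range] at hi hj
    rcases lt_trichotomy i j with h | h | h
    · exact (key σ i j h (by omega) hi' hj').elim
    · exact h
    · exact (key σ j i h (by omega) hj' hi').elim)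
  simpa using this

/-- A Chernoff bound for the sizes of subsets of an `n`-element set. -/
theorem card_filter_abs_card_le (n : ℕ) {δ : ℝ} (hδ : 0 < δ) :
    ((Finset.univ.filter fun A : Finset (Fin n) => δ * n ≤ |(n : ℝ) - 2 * A.card|).card : ℝ)
      ≤ 2 * (2 ^ n * Real.exp (-(n * δ ^ 2 / 2))) := by
  have hsum := Fintype.sum_pow_mul_eq_add_pow (Fin n) (Real.exp (-δ)) (Real.exp δ)
  have hsum' := Fintype.sum_pow_mul_eq_add_pow (Fin n) (Real.exp δ) (Real.exp (-δ))
  rw [Fintype.card_fin] at hsum hsum'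
  have hterm : ∀ (A : Finset (Fin n)) (t : ℝ),
      Real.exp (-t) ^ A.card * Real.exp t ^ (n - A.card)
        = Real.exp (t * (n - 2 * A.card)) := by
    intro A t
    have hA : A.card ≤ n := by simpa using Finset.card_le_univ A
    rw [← Real.exp_nat_mul, ← Real.exp_nat_mul, ← Real.exp_add, Nat.cast_sub hA]
    congr 1
    ring
  have hcosh : (Real.exp (-δ) + Real.exp δ) ^ n ≤ 2 ^ n * Real.exp (n * δ ^ 2 / 2) := by
    have h1 : Real.exp (-δ) + Real.exp δ = 2 * Real.cosh δ := by
      rw [Real.cosh_eq]; ring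
    rw [h1, mul_pow]
    refine mul_le_mul_of_nonneg_left ?_ (by positivity)
    calc Real.cosh δ ^ n ≤ Real.exp (δ ^ 2 / 2) ^ n :=
          pow_le_pow_left₀ (Real.cosh_pos δ).le (Real.cosh_le_exp_half_sq δ) n
      _ = Real.exp (n * δ ^ 2 / 2) := by
          rw [← Real.exp_nat_mul]; congr 1; ring
  have hmarkov : ((Finset.univ.filter fun A : Finset (Fin n) =>
      δ * n ≤ |(n : ℝ) - 2 * A.card|).card : ℝ) * Real.exp (n * δ ^ 2)
        ≤ 2 * (Real.exp (-δ) + Real.exp δ) ^ n := by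
    calc _ = ∑ A ∈ Finset.univ.filter (fun A : Finset (Fin n) =>
          δ * n ≤ |(n : ℝ) - 2 * A.card|), Real.exp (n * δ ^ 2) := by
            rw [Finset.sum_const, nsmul_eq_mul]
      _ ≤ ∑ A ∈ Finset.univ.filter (fun A : Finset (Fin n) =>
          δ * n ≤ |(n : ℝ) - 2 * A.card|),
            (Real.exp (-δ) ^ A.card * Real.exp δ ^ (n - A.card)
              + Real.exp δ ^ A.card * Real.exp (-δ) ^ (n - A.card)) := by
            refine Finset.sum_le_sum fun A hA => ?_
            rw [Finset.mem_filter] at hA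
            have h1 := hterm A δ
            have h2 := hterm A (-δ)
            rw [neg_neg] at h2
            rw [h1, h2]
            rcases le_abs.1 hA.2 with h | h
            · refine le_add_of_le_of_nonneg (Real.exp_le_exp.2 ?_) (Real.exp_pos _).le
              nlinarith
            · refine le_add_of_nonneg_of_le (Real.exp_pos _).le (Real.exp_le_exp.2 ?_)
              nlinarith
      _ ≤ ∑ A : Finset (Fin n),
            (Real.exp (-δ) ^ A.card * Real.exp δ ^ (n - A.card)
              + Real.exp δ ^ A.card * Real.exp (-δ) ^ (n - A.card)) :=
            Finset.sum_le_sum_of_subset_of_nonneg (Finset.subset_univ _)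
              fun A _ _ => by positivity
      _ = _ := by
            rw [Finset.sum_add_distrib, hsum, hsum', add_comm (Real.exp δ)]
            ring
  have hexp : Real.exp (n * δ ^ 2 / 2) * Real.exp (-(n * δ ^ 2)) =
      Real.exp (-(n * δ ^ 2 / 2)) := by
    rw [← Real.exp_add]; congr 1; ring
  rw [← hexp, ← mul_assoc (2 ^ n), ← mul_assoc 2, Real.exp_neg, ← div_eq_mul_inv,
    le_div_iff₀ (Real.exp_pos _)]
  linarith

theorem exists_card_filter_abs_card_le_mul_choose {δ ε : ℝ} (hδ : 0 < δ) (hε : 0 < ε) :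
    ∃ N : ℕ, ∀ n ≥ N,
      ((Finset.univ.filter fun A : Finset (Fin n) => δ * n ≤ |(n : ℝ) - 2 * A.card|).card : ℝ)
        ≤ ε * n.choose (n / 2) := by
  have hr : Real.exp (-(δ ^ 2 / 2)) < 1 := by
    rw [Real.exp_lt_one_iff]
    have := sq_pos_of_pos hδ
    linarith
  have hlim : Filter.Tendsto (fun n : ℕ => 2 * ((n : ℝ) * Real.exp (-(δ ^ 2 / 2)) ^ n
      + Real.exp (-(δ ^ 2 / 2)) ^ n)) Filter.atTop (nhds (2 * (0 + 0))) :=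
    ((tendsto_self_mul_const_pow_of_lt_one (Real.exp_pos _).le hr).add
      (tendsto_pow_atTop_nhds_zero_of_lt_one (Real.exp_pos _).le hr)).const_mul 2
  obtain ⟨N, hN⟩ := Filter.eventually_atTop.1 (hlim.eventually_lt_const (u := ε) (by simpa using hε))
  refine ⟨N, fun n hn => (card_filter_abs_card_le n hδ).trans ?_⟩
  have hpow : (2 : ℝ) ^ n ≤ (n + 1) * n.choose (n / 2) := by
    have : 2 ^ n ≤ (n + 1) * n.choose (n / 2) := by
      rw [← Nat.sum_range_choose, ← smul_eq_mul]
      calc _ ≤ (Finset.range (n + 1)).card • n.choose (n / 2) :=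
            Finset.sum_le_card_nsmul _ _ _ fun k _ => Nat.choose_le_middle k n
        _ = _ := by rw [Finset.card_range]
    exact_mod_cast this
  have hexp : Real.exp (-(n * δ ^ 2 / 2)) = Real.exp (-(δ ^ 2 / 2)) ^ n := by
    rw [← Real.exp_nat_mul]; congr 1; ring
  rw [hexp]
  calc _ ≤ 2 * (((n + 1) * n.choose (n / 2)) * Real.exp (-(δ ^ 2 / 2)) ^ n) := by gcongr
    _ = (2 * ((n : ℝ) * Real.exp (-(δ ^ 2 / 2)) ^ n + Real.exp (-(δ ^ 2 / 2)) ^ n))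
          * n.choose (n / 2) := by ring
    _ ≤ ε * n.choose (n / 2) := by
        gcongr
        exact (hN n hn).le

theorem exists_card_eq_card_tiltedChain {n p q m k : ℕ} (hpq : p < q)
    (hn : (q + p) * m + (q - p) ≤ n) (hk : p * m ≤ k) (hk' : k < q * m + (q - p)) :
    ∃ r < q - p, ∃ i < m + 1, k = (tiltedChain n p q m r i).card := by
  obtain ⟨d, rfl⟩ := Nat.exists_eq_add_of_lt hpq
  obtain ⟨l, rfl⟩ := Nat.exists_eq_add_of_le hk
  have hd : p + d + 1 - p = d + 1 := by omega
  rw [hd] at hn hk' ⊢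
  have hr : l % (d + 1) < d + 1 := Nat.mod_lt _ (by omega)
  have hi : l / (d + 1) < m + 1 := by
    rw [Nat.div_lt_iff_lt_mul (by omega)]
    nlinarith
  refine ⟨l % (d + 1), hr, l / (d + 1), hi, ?_⟩
  have hc := card_tiltedChain (n := n) (p := p) (q := p + d + 1) (m := m) (r := l % (d + 1))
    (i := l / (d + 1)) (by nlinarith) (by omega)
  have hdiv := Nat.mod_add_div l (d + 1)
  nlinarith

theorem stmt_10 (p q : ℕ) (hp : 0 < p) (hpq : p < q) (hco : Nat.Coprime p q)
    (ε : ℝ) (hε : 0 < ε) :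
    ∃ N : ℕ, ∀ n ≥ N, ∀ 𝒜 : Finset (Finset (Fin n)),
      (∀ A ∈ 𝒜, ∀ B ∈ 𝒜, A ≠ B → p * (A \ B).card ≠ q * (B \ A).card) →
      (𝒜.card : ℝ) ≤ ((q : ℝ) - p + ε) * (n.choose (n / 2) : ℝ) := by
  have hpq' : (p : ℝ) < q := by exact_mod_cast hpq
  have hp' : (0 : ℝ) < p := by exact_mod_cast hp
  obtain ⟨δ, hδ⟩ : ∃ δ : ℝ, δ = (q - p) / (2 * (q + p)) := ⟨_, rfl⟩
  have hδ0 : 0 < δ := by rw [hδ]; apply div_pos <;> linarith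
  have hδ2 : 2 * δ * (q + p) = q - p := by rw [hδ]; field_simp
  obtain ⟨N₁, hN₁⟩ := exists_card_filter_abs_card_le_mul_choose hδ0 hε
  obtain ⟨N₂, hN₂⟩ := exists_nat_gt (4 * q / δ)
  refine ⟨max (max N₁ N₂) (q - p), fun n hn 𝒜 h𝒜 => ?_⟩
  have hn₁ : N₁ ≤ n := by omega
  have hn₂ : (4 * q : ℝ) < δ * n := by
    rw [div_lt_iff₀ hδ0] at hN₂
    have : (N₂ : ℝ) ≤ n := by exact_mod_cast (by omega : N₂ ≤ n)
    nlinarith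
  obtain ⟨m, hm⟩ : ∃ m, m = (n - (q - p)) / (q + p) := ⟨_, rfl⟩
  have hm₁ : (q + p) * m + (q - p) ≤ n := by
    have := Nat.mul_div_le (n - (q - p)) (q + p)
    rw [← hm] at this
    omega
  have hm₂ : n < (q + p) * m + 2 * q := by
    have := Nat.lt_mul_div_succ (n - (q - p)) (show 0 < q + p by omega)
    rw [← hm, Nat.mul_succ] at this
    omega
  have hm₁' : ((q : ℝ) + p) * m ≤ n := by
    exact_mod_cast (by omega : (q + p) * m ≤ n)
  have hm₂' : (n : ℝ) < (q + p) * m + 2 * q := by exact_mod_cast hm₂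
  have hsub : 𝒜 ⊆ ((Finset.range (q - p)).biUnion fun r => 𝒜.filter fun A : Finset (Fin n) =>
      A.card ∈ (Finset.range (m + 1)).image fun i => (tiltedChain n p q m r i).card) ∪
      Finset.univ.filter fun A : Finset (Fin n) => δ * n ≤ |(n : ℝ) - 2 * A.card| := by
    intro A hA
    rw [Finset.mem_union]
    by_cases hk : p * m ≤ A.card ∧ A.card < q * m + (q - p)
    · obtain ⟨r, hr, i, hi, h⟩ := exists_card_eq_card_tiltedChain hpq hm₁ hk.1 hk.2
      left
      simp only [Finset.mem_biUnion, Finset.mem_filter, Finset.mem_image, Finset.mem_range]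
      exact ⟨r, hr, hA, i, hi, h.symm⟩
    · right
      simp only [Finset.mem_filter, Finset.mem_univ, true_and, le_abs]
      have hdm : 2 * δ * ((q + p) * m) = (q - p) * m := by rw [← mul_assoc, hδ2]
      have hdm' : 2 * δ * n < (q - p) * m + 2 * δ * (2 * q) := by nlinarith
      have hδ1 : 2 * δ < 1 := by nlinarith
      rcases not_and_or.1 hk with h | h
      · left
        have : (A.card : ℝ) ≤ p * m := by exact_mod_cast (by omega : A.card ≤ p * m)
        nlinarith
      · right
        have : (q * m : ℝ) ≤ A.card := by exact_mod_cast (by omega : q * m ≤ A.card)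
        nlinarith
  have hcard : 𝒜.card ≤ (q - p) * n.choose (n / 2) +
      (Finset.univ.filter fun A : Finset (Fin n) => δ * n ≤ |(n : ℝ) - 2 * A.card|).card := by
    refine (Finset.card_le_card hsub).trans ((Finset.card_union_le _ _).trans ?_)
    refine Nat.add_le_add_right ?_ _
    refine (Finset.card_biUnion_le_card_mul _ _ (n.choose (n / 2)) fun r hr => ?_).trans
      (by rw [Finset.card_range])
    rw [Finset.mem_range] at hr
    exact card_filter_tiltedChain_le (by omega) (by rw [← add_mul]; omega) 𝒜 h𝒜
  have hcard' : (𝒜.card : ℝ) ≤ ((q : ℝ) - p) * n.choose (n / 2) +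
      (Finset.univ.filter fun A : Finset (Fin n) =>
        δ * n ≤ |(n : ℝ) - 2 * A.card|).card := by
    rw [← Nat.cast_sub hpq.le]
    exact_mod_cast hcard
  linarith [hN₁ n hn₁]
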